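/- arXiv:2604.19229 — 2 statements merged into one kernel-verified Lean document; each statement's English description precedes it below -/
import Mathlib

section
/- Let A ∈ ℝ^{2n×2n} be symmetric positive definite with symplectic eigenvalues 0 < d₁ ≤ … ≤ d_n, let 1 ≤ p ≤ n, and let β > d_p. Suppose X ∈ ℝ^{2n×2p} is a first-order stationary point of f_β (AX − βJ_nX(XᵀJ_nX − J_p) = 0) and the Hessian quadratic form is positive semidefinite, i.e. for all Y ∈ ℝ^{2n×2p}: tr(YᵀAY) − β·tr((YᵀJ_nY)(XᵀJ_nX − J_p)) + (β/2)‖YᵀJ_nX + XᵀJ_nY‖_F² ≥ 0. Then X is a global minimizer of f_β over ℝ^{2n×2p}. -/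
open Matrix BigOperators

noncomputable section

/-- The Poisson matrix `J_k = [[0, I],[-I, 0]]`, on index type `Fin k ⊕ Fin k`
(representing dimension `2k`). -/
def Jmat (k : ℕ) : Matrix (Fin k ⊕ Fin k) (Fin k ⊕ Fin k) ℝ :=
  Matrix.fromBlocks 0 1 (-1) 0

/-- Squared Frobenius norm `‖M‖_F² = tr(Mᵀ M)`. -/
def frobSq {m k : Type*} [Fintype m] [Fintype k] (M : Matrix m k ℝ) : ℝ :=
  Matrix.trace (Mᵀ * M)

/-- The Frobenius norm. -/
def frobNorm {m k : Type*} [Fintype m] [Fintype k] (M : Matrix m k ℝ) : ℝ :=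
  Real.sqrt (frobSq M)

/-- The trace-penalty function `f_β`. -/
def fPen (n p : ℕ) (A : Matrix (Fin n ⊕ Fin n) (Fin n ⊕ Fin n) ℝ) (β : ℝ)
    (X : Matrix (Fin n ⊕ Fin n) (Fin p ⊕ Fin p) ℝ) : ℝ :=
  (1 / 2) * Matrix.trace (Xᵀ * A * X) + (β / 4) * frobSq (Xᵀ * Jmat n * X - Jmat p)

/-- The gradient `∇f_β(X) = AX - βJ_nX(XᵀJ_nX - J_p)`. -/
def gradPen (n p : ℕ) (A : Matrix (Fin n ⊕ Fin n) (Fin n ⊕ Fin n) ℝ) (β : ℝ)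
    (X : Matrix (Fin n ⊕ Fin n) (Fin p ⊕ Fin p) ℝ) :
    Matrix (Fin n ⊕ Fin n) (Fin p ⊕ Fin p) ℝ :=
  A * X - β • (Jmat n * X * (Xᵀ * Jmat n * X - Jmat p))

lemma trace_mul_transpose_self_nonneg {ι κ : Type*} [Fintype ι] [Fintype κ] (V : Matrix ι κ ℝ) :
    0 ≤ trace (V * Vᵀ) := by
  rw [trace]
  refine Finset.sum_nonneg fun i _ => ?_
  rw [diag_apply, mul_apply]
  exact Finset.sum_nonneg fun j _ => mul_self_nonneg _

lemma eq_zero_of_trace_mul_transpose_self {ι κ : Type*} [Fintype ι] [Fintype κ]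
    {V : Matrix ι κ ℝ} (h : trace (V * Vᵀ) ≤ 0) : V = 0 := by
  have h0 := le_antisymm h (trace_mul_transpose_self_nonneg V)
  rwa [← conjTranspose_eq_transpose_of_trivial, trace_mul_conjTranspose_self_eq_zero_iff] at h0

lemma mul_transpose_self_diag_nonneg {ι κ : Type*} [Fintype κ] (V : Matrix ι κ ℝ) (i : ι) :
    0 ≤ (V * Vᵀ) i i := by
  rw [mul_apply]
  exact Finset.sum_nonneg fun j _ => mul_self_nonneg _

/-- A critical point of the penalty function intertwines the two complex structures, and its
columns span an invariant subspace of `D`. -/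
lemma critical_point_structure {ι κ : Type*} [Fintype ι] [Fintype κ] [DecidableEq ι]
    [DecidableEq κ] {J : Matrix ι ι ℝ} {Q : Matrix κ κ ℝ} {e : ι → ℝ} {β : ℝ}
    {W : Matrix ι κ ℝ} (hJt : Jᵀ = -J) (hJJ : J * J = -1) (hQt : Qᵀ = -Q) (hQQ : Q * Q = -1)
    (he : ∀ i, 0 < e i) (hDJ : diagonal e * J = J * diagonal e) (hβ : 0 < β)
    (hW : diagonal e * W = β • (J * W * (Wᵀ * J * W - Q))) :
    J * W = W * Q ∧ diagonal e * W = β • (W - W * Wᵀ * W) := by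
  obtain ⟨M, hM⟩ : ∃ M, M = Wᵀ * J * W - Q := ⟨_, rfl⟩
  rw [← hM] at hW
  have hK : Wᵀ * (J * W) = M + Q := by rw [hM, Matrix.mul_assoc]; abel
  have hMt : Mᵀ = -M := by
    rw [hM]
    simp only [transpose_sub, transpose_mul, transpose_transpose, hJt, hQt, Matrix.mul_assoc,
      Matrix.neg_mul, Matrix.mul_neg]
    abel
  have hWDW : Wᵀ * (diagonal e * W) = β • ((M + Q) * M) := by
    rw [hW, Matrix.mul_smul, ← Matrix.mul_assoc, hK]
  have hcomm : Q * M = M * Q := by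
    have h := congrArg transpose hWDW
    simp only [transpose_mul, transpose_transpose, diagonal_transpose, transpose_smul,
      transpose_add, hMt, hQt, Matrix.mul_assoc] at h
    rw [hWDW] at h
    have h2 := smul_right_injective _ hβ.ne' h
    simp only [Matrix.add_mul, Matrix.mul_add, Matrix.neg_mul, Matrix.mul_neg] at h2
    have h3 : M * M + Q * M = M * M + M * Q := by rw [h2]; abel
    exact add_left_cancel h3
  have hJJ' : ∀ Z : Matrix ι κ ℝ, J * (J * Z) = -Z := fun Z => by
    rw [← Matrix.mul_assoc, hJJ]; simp
  have hQQ' : ∀ Z : Matrix κ κ ℝ, Q * (Q * Z) = -Z := fun Z => by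
    rw [← Matrix.mul_assoc, hQQ]; simp
  have hDJW : diagonal e * (J * (W * Q)) = -(β • (W * (Q * M))) := by
    rw [← Matrix.mul_assoc, hDJ, Matrix.mul_assoc, ← Matrix.mul_assoc (diagonal e) W, hW,
      hcomm]
    simp only [Matrix.mul_smul, Matrix.smul_mul, Matrix.mul_assoc, hJJ', smul_neg]
  obtain ⟨U, hU⟩ : ∃ U, U = W - J * (W * Q) := ⟨_, rfl⟩
  obtain ⟨V, hV⟩ : ∃ V, V = W + J * (W * Q) := ⟨_, rfl⟩
  have hDU : diagonal e * U = β • (U * (Q * M)) := by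
    rw [hU, Matrix.mul_sub, hDJW, hW]
    simp only [Matrix.sub_mul, Matrix.mul_assoc, hQQ', Matrix.mul_neg, smul_sub, smul_neg]
    abel
  have hDV : diagonal e * V = -(β • (V * (Q * M))) := by
    rw [hV, Matrix.mul_add, hDJW, hW]
    simp only [Matrix.add_mul, Matrix.mul_assoc, hQQ', Matrix.mul_neg, smul_add, smul_neg]
    abel
  have hQMt : (Q * M)ᵀ = Q * M := by
    rw [transpose_mul, hMt, hQt, hcomm]; simp
  have hVD : Vᵀ * diagonal e = -(β • (Q * M * Vᵀ)) := by
    have h := congrArg transpose hDV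
    simpa only [transpose_mul, transpose_neg, transpose_smul, hQMt, diagonal_transpose] using h
  have hUV : U * Vᵀ = 0 := by
    have h : diagonal e * (U * Vᵀ) = -(U * Vᵀ * diagonal e) := by
      rw [← Matrix.mul_assoc, hDU, Matrix.mul_assoc U, hVD]
      simp only [Matrix.mul_neg, neg_neg, Matrix.mul_smul, Matrix.smul_mul, Matrix.mul_assoc]
    ext i k
    have h2 := congrFun (congrFun h i) k
    rw [diagonal_mul, neg_apply, mul_diagonal] at h2
    have h3 : (e i + e k) * (U * Vᵀ) i k = 0 := by linarith
    exact (mul_eq_zero.mp h3).resolve_left (add_pos (he i) (he k)).ne'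
  have hdiff : Uᵀ * U - Vᵀ * V = (4 : ℝ) • (1 - Q * M) := by
    have h1 : Wᵀ * (J * (W * Q)) = Q * M - 1 := by
      rw [← Matrix.mul_assoc J, ← Matrix.mul_assoc, hK, Matrix.add_mul, hQQ, hcomm]; abel
    have h2 : (J * (W * Q))ᵀ * W = Q * M - 1 := by
      have h := congrArg transpose h1
      simpa only [transpose_mul, transpose_transpose, transpose_sub, transpose_one, hMt, hQt,
        Matrix.mul_neg, Matrix.neg_mul, neg_neg, ← hcomm] using h
    rw [hU, hV]
    simp only [transpose_sub, transpose_add, Matrix.sub_mul, Matrix.add_mul, Matrix.mul_sub,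
      Matrix.mul_add, h1, h2]
    module
  have hV0 : V = 0 := by
    apply eq_zero_of_trace_mul_transpose_self
    have h : -(V * Vᵀ * (V * Vᵀ)ᵀ) =
        (4 : ℝ) • (V * Vᵀ) + (4 / β) • (V * Vᵀ * diagonal e) := by
      have h1 := congrArg (fun Z => V * (Z * Vᵀ)) hdiff
      simp only [Matrix.sub_mul, Matrix.smul_mul, Matrix.mul_smul, Matrix.mul_sub,
        Matrix.mul_assoc, hUV, Matrix.mul_zero, zero_sub, Matrix.one_mul, Matrix.mul_neg] at h1
      simp only [transpose_mul, transpose_transpose, Matrix.mul_assoc, hVD, Matrix.mul_neg,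
        Matrix.mul_smul, smul_neg, smul_smul]
      rw [h1, div_mul_cancel₀ _ hβ.ne']
      module
    have h2 := congrArg trace h
    rw [trace_neg, trace_add, trace_smul, trace_smul, smul_eq_mul, smul_eq_mul] at h2
    have h3 := trace_mul_transpose_self_nonneg (V * Vᵀ)
    have h4 : 0 ≤ trace (V * Vᵀ * diagonal e) := by
      rw [trace]
      refine Finset.sum_nonneg fun i _ => ?_
      rw [diag_apply, mul_diagonal]
      exact mul_nonneg (mul_transpose_self_diag_nonneg V i) (he i).le
    have h5 : 0 ≤ 4 / β * trace (V * Vᵀ * diagonal e) := by positivity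
    linarith
  have hJW : J * W = W * Q := by
    have h := congrArg (fun Z => J * Z) (hV.symm.trans hV0)
    simp only [Matrix.mul_add, hJJ', Matrix.mul_zero] at h
    exact (eq_neg_of_add_eq_zero_left h).trans (neg_neg _)
  refine ⟨hJW, ?_⟩
  have hQM : Q * M = 1 - Wᵀ * W := by
    have h : M = Wᵀ * W * Q - Q := by
      rw [eq_sub_iff_add_eq, ← hK, hJW, Matrix.mul_assoc]
    rw [hcomm, h, Matrix.sub_mul, Matrix.mul_assoc, hQQ, Matrix.mul_neg, Matrix.mul_one]
    abel
  rw [hW, hJW, Matrix.mul_assoc, hQM, Matrix.mul_sub, Matrix.mul_one, Matrix.mul_assoc]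

lemma coeff_one_eq_zero {a b c e : ℝ}
    (h : ∀ t : ℝ, 0 ≤ a * t + b * t ^ 2 + c * t ^ 3 + e * t ^ 4) : a = 0 := by
  have hd : HasDerivAt (fun t : ℝ => a * t + b * t ^ 2 + c * t ^ 3 + e * t ^ 4) a 0 := by
    have h1 := ((((hasDerivAt_id (0 : ℝ)).const_mul a).add
      (((hasDerivAt_id (0 : ℝ)).pow 2).const_mul b)).add
      (((hasDerivAt_id (0 : ℝ)).pow 3).const_mul c)).add
      (((hasDerivAt_id (0 : ℝ)).pow 4).const_mul e)
    exact h1.congr_deriv (by norm_num)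
  refine IsLocalMin.hasDerivAt_eq_zero (Filter.Eventually.of_forall fun t => ?_) hd
  simpa using h t

lemma Jmat_transpose (k : ℕ) : (Jmat k)ᵀ = -Jmat k := by
  simp [Jmat, fromBlocks_transpose, fromBlocks_neg]

lemma Jmat_mul_self (k : ℕ) : Jmat k * Jmat k = -1 := by
  simp [Jmat, fromBlocks_multiply, ← fromBlocks_one, fromBlocks_neg]

lemma diagonal_mul_Jmat {n : ℕ} (d : Fin n → ℝ) :
    diagonal (Sum.elim d d) * Jmat n = Jmat n * diagonal (Sum.elim d d) := by
  rw [Jmat, ← fromBlocks_diagonal, fromBlocks_multiply, fromBlocks_multiply]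
  simp

lemma frobSq_eq_sum {m k : Type*} [Fintype m] [Fintype k] (M : Matrix m k ℝ) :
    frobSq M = ∑ j, ∑ i, M i j ^ 2 := by
  simp [frobSq, trace, mul_apply, sq]

lemma frobSq_nonneg {m k : Type*} [Fintype m] [Fintype k] (M : Matrix m k ℝ) :
    0 ≤ frobSq M := by
  rw [frobSq_eq_sum]; positivity

lemma gradPen_eq_zero_of_isMin {n p : ℕ} {D : Matrix (Fin n ⊕ Fin n) (Fin n ⊕ Fin n) ℝ}
    (hD : Dᵀ = D) {β : ℝ} {W : Matrix (Fin n ⊕ Fin n) (Fin p ⊕ Fin p) ℝ}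
    (h : ∀ Y, fPen n p D β W ≤ fPen n p D β Y) : gradPen n p D β W = 0 := by
  have key : ∀ E : Matrix (Fin n ⊕ Fin n) (Fin p ⊕ Fin p) ℝ, trace (Eᵀ * gradPen n p D β W) = 0 := by
    intro E
    obtain ⟨M, hM⟩ : ∃ M, M = Wᵀ * Jmat n * W - Jmat p := ⟨_, rfl⟩
    obtain ⟨L, hL⟩ : ∃ L, L = Eᵀ * Jmat n * W + Wᵀ * Jmat n * E := ⟨_, rfl⟩
    obtain ⟨N, hN⟩ : ∃ N, N = Eᵀ * Jmat n * E := ⟨_, rfl⟩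
    have hMt : Mᵀ = -M := by
      rw [hM]
      simp only [transpose_sub, transpose_mul, transpose_transpose, Jmat_transpose,
        Matrix.mul_assoc, Matrix.neg_mul, Matrix.mul_neg]
      abel
    have hML : trace (Mᵀ * L) = -(2 * trace (Eᵀ * (Jmat n * W * M))) := by
      have h1 : trace (M * (Eᵀ * Jmat n * W)) = trace (Eᵀ * (Jmat n * W * M)) := by
        rw [trace_mul_comm]; simp only [Matrix.mul_assoc]
      have h2 : trace (M * (Wᵀ * Jmat n * E)) = trace (Eᵀ * (Jmat n * W * M)) := by
        rw [← trace_transpose]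
        simp only [transpose_mul, transpose_transpose, Jmat_transpose, hMt, Matrix.mul_assoc,
          Matrix.neg_mul, Matrix.mul_neg, neg_neg]
      rw [hMt, hL, Matrix.neg_mul, Matrix.mul_add, trace_neg, trace_add, h1, h2]; ring
    have hLM : trace (Lᵀ * M) = trace (Mᵀ * L) := by
      rw [← trace_transpose, transpose_mul, transpose_transpose]
    have hWE : trace (Wᵀ * D * E) = trace (Eᵀ * D * W) := by
      rw [← trace_transpose]
      simp only [transpose_mul, transpose_transpose, hD, Matrix.mul_assoc]
    have hg : gradPen n p D β W = D * W - β • (Jmat n * W * M) := by rw [gradPen, hM]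
    refine coeff_one_eq_zero (b := 1 / 2 * trace (Eᵀ * D * E) + β / 4 *
      (trace (Mᵀ * N) + trace (Lᵀ * L) + trace (Nᵀ * M)))
      (c := β / 4 * (trace (Lᵀ * N) + trace (Nᵀ * L))) (e := β / 4 * trace (Nᵀ * N)) fun t => ?_
    have ht := h (W + t • E)
    have hexp : (W + t • E)ᵀ * Jmat n * (W + t • E) - Jmat p = M + t • L + t ^ 2 • N := by
      rw [hM, hL, hN]
      simp only [transpose_add, transpose_smul, Matrix.add_mul, Matrix.mul_add, Matrix.smul_mul,
        Matrix.mul_smul]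
      module
    rw [fPen, fPen, hexp, ← hM, frobSq, frobSq] at ht
    simp only [transpose_add, transpose_smul, Matrix.add_mul, Matrix.mul_add, Matrix.smul_mul,
      Matrix.mul_smul, trace_add, trace_smul, smul_eq_mul, hLM, hML, hWE] at ht
    rw [hg, Matrix.mul_sub, Matrix.mul_smul, trace_sub, trace_smul, smul_eq_mul,
      ← Matrix.mul_assoc Eᵀ D W]
    linarith
  apply eq_zero_of_trace_mul_transpose_self
  rw [trace_mul_comm, key]

lemma exists_isMin_fPen {n p : ℕ} {e : Fin n ⊕ Fin n → ℝ} (he : ∀ i, 0 < e i) {β : ℝ}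
    (hβ : 0 < β) : ∃ W, ∀ Y, fPen n p (diagonal e) β W ≤ fPen n p (diagonal e) β Y := by
  have hcont : Continuous (fPen n p (diagonal e) β) := by
    unfold fPen frobSq
    fun_prop
  obtain ⟨c, hc⟩ : ∃ c, c = fPen n p (diagonal e) β 0 := ⟨_, rfl⟩
  have hbound : ∀ Y : Matrix (Fin n ⊕ Fin n) (Fin p ⊕ Fin p) ℝ,
      fPen n p (diagonal e) β Y ≤ c → ∀ i j, Y i j ^ 2 ≤ 2 * c / e i := by
    intro Y hY i j
    have h1 : trace (Yᵀ * diagonal e * Y) = ∑ j, ∑ i, e i * Y i j ^ 2 := by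
      simp only [trace, diag_apply]
      simp_rw [mul_apply (M := Yᵀ * diagonal e), mul_diagonal, transpose_apply]
      refine Finset.sum_congr rfl fun j _ => Finset.sum_congr rfl fun i _ => by ring
    have h2 := frobSq_nonneg (Yᵀ * Jmat n * Y - Jmat p)
    have h3 : e i * Y i j ^ 2 ≤ trace (Yᵀ * diagonal e * Y) := by
      rw [h1]
      have hn : ∀ j i, 0 ≤ e i * Y i j ^ 2 := fun j i => mul_nonneg (he i).le (sq_nonneg _)
      calc e i * Y i j ^ 2 ≤ ∑ i, e i * Y i j ^ 2 :=
            Finset.single_le_sum (fun i _ => hn j i) (Finset.mem_univ i)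
        _ ≤ _ := Finset.single_le_sum (f := fun j => ∑ i, e i * Y i j ^ 2)
            (fun j _ => Finset.sum_nonneg fun i _ => hn j i) (Finset.mem_univ j)
    rw [le_div_iff₀ (he i)]
    rw [fPen] at hY
    have : 0 ≤ β / 4 * frobSq (Yᵀ * Jmat n * Y - Jmat p) := by positivity
    linarith
  obtain ⟨s, hs⟩ : ∃ s : Set (Matrix (Fin n ⊕ Fin n) (Fin p ⊕ Fin p) ℝ),
      s = Set.pi Set.univ fun i => Set.pi Set.univ fun _ =>
        Set.Icc (-√(2 * c / e i)) (√(2 * c / e i)) := ⟨_, rfl⟩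
  have hsc : IsCompact s := by
    rw [hs]
    exact isCompact_univ_pi fun i => isCompact_univ_pi fun _ => isCompact_Icc
  have hmem : ∀ Y, fPen n p (diagonal e) β Y ≤ c → Y ∈ s := by
    intro Y hY
    rw [hs]
    exact fun i _ j _ => abs_le.mp (Real.abs_le_sqrt (hbound Y hY i j))
  obtain ⟨W, -, hW⟩ := hsc.exists_isMinOn ⟨0, hmem 0 hc.ge⟩ hcont.continuousOn
  refine ⟨W, fun Y => ?_⟩
  by_cases hY : fPen n p (diagonal e) β Y ≤ c
  · exact hW (hmem Y hY)
  · exact (hW (hmem 0 hc.ge)).trans (hc ▸ (not_le.mp hY).le)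

lemma fPen_eq_of_structure {n p : ℕ} {D : Matrix (Fin n ⊕ Fin n) (Fin n ⊕ Fin n) ℝ} {β : ℝ}
    {W : Matrix (Fin n ⊕ Fin n) (Fin p ⊕ Fin p) ℝ} (hJW : Jmat n * W = W * Jmat p)
    (hDW : D * W = β • (W - W * Wᵀ * W)) :
    fPen n p D β W = β / 4 * (2 * p - trace (W * Wᵀ * (W * Wᵀ))) := by
  have h1 : trace (Wᵀ * D * W) = β * (trace (W * Wᵀ) - trace (W * Wᵀ * (W * Wᵀ))) := by
    rw [Matrix.mul_assoc, hDW, Matrix.mul_smul, trace_smul, Matrix.mul_sub, trace_sub,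
      trace_mul_comm Wᵀ W, Matrix.mul_assoc W, trace_mul_comm Wᵀ]
    simp only [Matrix.mul_assoc, smul_eq_mul]
  have h2 : Wᵀ * Jmat n * W - Jmat p = (Wᵀ * W - 1) * Jmat p := by
    rw [Matrix.mul_assoc, hJW, Matrix.sub_mul, Matrix.one_mul, Matrix.mul_assoc]
  have h3 : frobSq ((Wᵀ * W - 1) * Jmat p) =
      trace (W * Wᵀ * (W * Wᵀ)) - 2 * trace (W * Wᵀ) + 2 * p := by
    have h4 : trace (Wᵀ * W * (Wᵀ * W)) = trace (W * Wᵀ * (W * Wᵀ)) := by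
      rw [Matrix.mul_assoc, trace_mul_comm]
      simp only [Matrix.mul_assoc]
    rw [frobSq, trace_mul_comm, transpose_mul, ← Matrix.mul_assoc, Matrix.mul_assoc _ (Jmat p),
      Jmat_transpose, Matrix.mul_neg, Jmat_mul_self, neg_neg, Matrix.mul_one]
    simp only [transpose_sub, transpose_mul, transpose_transpose, transpose_one, Matrix.sub_mul,
      Matrix.mul_sub, Matrix.mul_one, Matrix.one_mul, trace_sub, trace_one, h4,
      trace_mul_comm Wᵀ W, Fintype.card_sum, Fintype.card_fin]
    push_cast
    ring
  rw [fPen, h1, h2, h3]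
  ring

lemma dotProduct_mulVec_self_eq_zero {κ : Type*} [Fintype κ] {Q : Matrix κ κ ℝ} (hQt : Qᵀ = -Q)
    (u : κ → ℝ) : u ⬝ᵥ Q *ᵥ u = 0 := by
  have h : u ⬝ᵥ Q *ᵥ u = -(u ⬝ᵥ Q *ᵥ u) := by
    conv_lhs => rw [dotProduct_mulVec, ← mulVec_transpose, hQt, neg_mulVec, neg_dotProduct,
      dotProduct_comm]
  linarith

lemma trace_transpose_mul_mul_vecMulVec_add {ι κ : Type*} [Fintype ι] [Fintype κ]
    (N : Matrix ι ι ℝ) (a b : ι → ℝ) (u v : κ → ℝ) (huv : u ⬝ᵥ v = 0) :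
    trace ((vecMulVec a u + vecMulVec b v)ᵀ * N * (vecMulVec a u + vecMulVec b v)) =
      (a ⬝ᵥ N *ᵥ a) * (u ⬝ᵥ u) + (b ⬝ᵥ N *ᵥ b) * (v ⬝ᵥ v) := by
  have hvu : v ⬝ᵥ u = 0 := by rw [dotProduct_comm, huv]
  have h : ∀ (x z : ι → ℝ) (y t : κ → ℝ),
      trace (vecMulVec y x * (N * vecMulVec z t)) = (x ⬝ᵥ N *ᵥ z) * (y ⬝ᵥ t) := fun x z y t => by
    rw [mul_vecMulVec, vecMulVec_mul_vecMulVec, vecMulVec_smul, trace_smul, trace_vecMulVec,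
      smul_eq_mul]
  simp only [transpose_add, transpose_vecMulVec, Matrix.mul_assoc, Matrix.mul_add,
    Matrix.add_mul, trace_add, h, huv, hvu, mul_zero]
  ring

/-- The second-order condition at a critical point, tested on the complex rank-one directions
`w uᴴ`, where `w` is orthogonal to the columns of `W`. -/
lemma second_order_vector_inequality {n p : ℕ} {b : Fin n ⊕ Fin n → ℝ} {β : ℝ} (hβ : 0 < β)
    {W : Matrix (Fin n ⊕ Fin n) (Fin p ⊕ Fin p) ℝ} (hJW : Jmat n * W = W * Jmat p)
    (hBJ : diagonal b * Jmat n = Jmat n * diagonal b)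
    (hhess : ∀ Y : Matrix (Fin n ⊕ Fin n) (Fin p ⊕ Fin p) ℝ,
      0 ≤ trace (Yᵀ * (β • (1 - diagonal b)) * Y)
          - β * trace ((Yᵀ * Jmat n * Y) * (Wᵀ * Jmat n * W - Jmat p))
          + (β / 2) * frobSq (Yᵀ * Jmat n * W + Wᵀ * Jmat n * Y))
    (w : Fin n ⊕ Fin n → ℝ) (u : Fin p ⊕ Fin p → ℝ) (hw : Wᵀ *ᵥ w = 0) :
    (w ⬝ᵥ diagonal b *ᵥ w) * (u ⬝ᵥ u) ≤ (w ⬝ᵥ w) * ((W *ᵥ u) ⬝ᵥ (W *ᵥ u)) := by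
  have hiso : ∀ (k : ℕ) (x y : Fin k ⊕ Fin k → ℝ),
      (Jmat k *ᵥ x) ⬝ᵥ (Jmat k *ᵥ y) = x ⬝ᵥ y := fun k x y => by
    rw [dotProduct_mulVec, ← mulVec_transpose, Jmat_transpose, mulVec_mulVec, Matrix.neg_mul,
      Jmat_mul_self, neg_neg, one_mulVec]
  have hWJ : Wᵀ * Jmat n = Jmat p * Wᵀ := by
    have h := congrArg transpose hJW
    simp only [transpose_mul, Jmat_transpose, Matrix.mul_neg, Matrix.neg_mul, neg_inj] at h
    exact h
  obtain ⟨Y, hY⟩ : ∃ Y, Y = vecMulVec w u + vecMulVec (Jmat n *ᵥ w) (Jmat p *ᵥ u) := ⟨_, rfl⟩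
  have hvJ : ∀ (k : ℕ) (x : Fin k ⊕ Fin k → ℝ), x ᵥ* Jmat k = -(Jmat k *ᵥ x) := fun k x => by
    rw [← mulVec_transpose, Jmat_transpose, neg_mulVec]
  have hJJ : ∀ (k : ℕ) (x : Fin k ⊕ Fin k → ℝ), Jmat k *ᵥ (Jmat k *ᵥ x) = -x := fun k x => by
    rw [mulVec_mulVec, Jmat_mul_self, neg_mulVec, one_mulVec]
  have hJY : Jmat n * Y = Y * Jmat p := by
    rw [hY, Matrix.mul_add, Matrix.add_mul, mul_vecMulVec, mul_vecMulVec, vecMulVec_mul,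
      vecMulVec_mul, hvJ, hvJ, hJJ, hJJ, neg_neg, neg_vecMulVec, vecMulVec_neg, add_comm]
  have hWY : Wᵀ * Y = 0 := by
    rw [hY, Matrix.mul_add, mul_vecMulVec, mul_vecMulVec, mulVec_mulVec, hWJ, ← mulVec_mulVec,
      hw, mulVec_zero, zero_vecMulVec, zero_vecMulVec, add_zero]
  have hYW : Yᵀ * W = 0 := by
    have h := congrArg transpose hWY
    simpa only [transpose_mul, transpose_transpose, transpose_zero] using h
  have hM : Wᵀ * Jmat n * W - Jmat p = Jmat p * (Wᵀ * W - 1) := by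
    rw [hWJ, Matrix.mul_assoc, Matrix.mul_sub, Matrix.mul_one]
  have h0 := hhess Y
  have hz : Yᵀ * Jmat n * W + Wᵀ * Jmat n * Y = 0 := by
    rw [Matrix.mul_assoc, hJW, ← Matrix.mul_assoc, hYW, Matrix.mul_assoc, hJY,
      ← Matrix.mul_assoc, hWY]
    simp
  have h1 : (Yᵀ * Jmat n * Y) * (Wᵀ * Jmat n * W - Jmat p) = Yᵀ * Y - Yᵀ * Y * (Wᵀ * W) := by
    rw [hM, Matrix.mul_assoc Yᵀ, hJY, ← Matrix.mul_assoc Yᵀ, Matrix.mul_assoc,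
      ← Matrix.mul_assoc (Jmat p), Jmat_mul_self]
    simp [Matrix.mul_sub]
  have h2 : trace (Yᵀ * Y * (Wᵀ * W)) = trace ((Y * Wᵀ)ᵀ * 1 * (Y * Wᵀ)) := by
    rw [← Matrix.mul_assoc, trace_mul_comm, Matrix.mul_one, transpose_mul, transpose_transpose]
    simp only [Matrix.mul_assoc]
  have h3 : Y * Wᵀ = vecMulVec w (W *ᵥ u) + vecMulVec (Jmat n *ᵥ w) (Jmat n *ᵥ (W *ᵥ u)) := by
    rw [hY, Matrix.add_mul, vecMulVec_mul, vecMulVec_mul, vecMul_transpose, vecMul_transpose,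
      mulVec_mulVec, ← hJW, mulVec_mulVec]
  have h4 : trace (Yᵀ * diagonal b * Y) = 2 * ((w ⬝ᵥ diagonal b *ᵥ w) * (u ⬝ᵥ u)) := by
    rw [hY, trace_transpose_mul_mul_vecMulVec_add _ _ _ _ _
      (dotProduct_mulVec_self_eq_zero (Jmat_transpose p) u), hiso,
      mulVec_mulVec w (diagonal b) (Jmat n), hBJ, ← mulVec_mulVec, hiso]
    ring
  have h5 : trace (Yᵀ * Y * (Wᵀ * W)) = 2 * ((w ⬝ᵥ w) * ((W *ᵥ u) ⬝ᵥ (W *ᵥ u))) := by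
    rw [h2, h3, trace_transpose_mul_mul_vecMulVec_add _ _ _ _ _
      (dotProduct_mulVec_self_eq_zero (Jmat_transpose n) _), one_mulVec, one_mulVec, hiso, hiso]
    ring
  rw [hz, h1] at h0
  simp only [Matrix.mul_smul, Matrix.smul_mul, Matrix.mul_sub, Matrix.sub_mul, Matrix.mul_one,
    trace_smul, trace_sub, smul_eq_mul, h4, h5, frobSq, Matrix.mul_zero, trace_zero] at h0
  refine le_of_mul_le_mul_left ?_ (mul_pos two_pos hβ)
  linarith

lemma mul_gram_diag {ι κ : Type*} [Fintype κ] (b : ι → ℝ) (W : Matrix ι κ ℝ) (i : ι) :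
    b i * (W * Wᵀ) i i = b i ^ 2 * ((b i)⁻¹ * (W * Wᵀ) i i) := by
  rcases eq_or_ne (b i) 0 with h | h
  · rw [h]; simp
  · field_simp

section Weights

variable {ι κ : Type*} [Fintype ι] [Fintype κ] [DecidableEq ι] {b : ι → ℝ} {W : Matrix ι κ ℝ}

lemma gram_sq (hW : W * Wᵀ * W = diagonal b * W) :
    W * Wᵀ * (W * Wᵀ) = diagonal b * (W * Wᵀ) := by
  rw [← Matrix.mul_assoc, hW, Matrix.mul_assoc]

lemma gram_diag_sq_le (hW : W * Wᵀ * W = diagonal b * W) (i : ι) :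
    (W * Wᵀ) i i ^ 2 ≤ b i * (W * Wᵀ) i i := by
  have h := congrFun (congrFun (gram_sq hW) i) i
  rw [diagonal_mul, mul_apply] at h
  rw [← h]
  have hs : ∀ k, (W * Wᵀ) i k * (W * Wᵀ) k i = (W * Wᵀ) i k ^ 2 := fun k => by
    rw [sq, ← transpose_apply (W * Wᵀ) i k, transpose_mul, transpose_transpose]
  simp_rw [hs]
  exact Finset.single_le_sum (f := fun k => (W * Wᵀ) i k ^ 2) (fun k _ => sq_nonneg _)
    (Finset.mem_univ i)

lemma gram_diag_eq_zero (hW : W * Wᵀ * W = diagonal b * W) {i : ι} (hi : b i ≤ 0) :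
    (W * Wᵀ) i i = 0 := by
  have h1 := gram_diag_sq_le hW i
  have h2 := mul_nonpos_of_nonpos_of_nonneg hi (mul_transpose_self_diag_nonneg W i)
  exact pow_eq_zero_iff two_ne_zero |>.mp (le_antisymm (h1.trans h2) (sq_nonneg _))

lemma row_eq_zero (hW : W * Wᵀ * W = diagonal b * W) {i : ι} (hi : b i ≤ 0) (j : κ) :
    W i j = 0 := by
  have h := gram_diag_eq_zero hW hi
  rw [mul_apply] at h
  exact mul_self_eq_zero.mp
    ((Finset.sum_eq_zero_iff_of_nonneg fun j _ => mul_self_nonneg (W i j)).mp h j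
      (Finset.mem_univ j))

lemma diagonal_inv_mul_diagonal_mul (hW : W * Wᵀ * W = diagonal b * W) :
    diagonal b⁻¹ * (diagonal b * W) = W := by
  ext i j
  rw [diagonal_mul, diagonal_mul, Pi.inv_apply]
  rcases eq_or_ne (b i) 0 with h | h
  · rw [row_eq_zero hW h.le, mul_zero, mul_zero]
  · rw [inv_mul_cancel_left₀ h]

lemma gram_mul_diagonal (hW : W * Wᵀ * W = diagonal b * W) :
    W * Wᵀ * diagonal b = diagonal b * (W * Wᵀ) := by
  have h := congrArg transpose (gram_sq hW)
  simp only [transpose_mul, transpose_transpose, diagonal_transpose] at h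
  rw [← h, gram_sq hW]

lemma gram_mul_diagonal_inv (hW : W * Wᵀ * W = diagonal b * W) :
    W * Wᵀ * diagonal b⁻¹ = diagonal b⁻¹ * (W * Wᵀ) := by
  ext i k
  have h := congrFun (congrFun (gram_mul_diagonal hW) i) k
  rw [mul_diagonal, diagonal_mul] at h ⊢
  rcases eq_or_ne (b i) (b k) with hik | hik
  · rw [Pi.inv_apply, Pi.inv_apply, hik, mul_comm]
  · have h2 : (b i - b k) * (W * Wᵀ) i k = 0 := by linarith
    rw [(mul_eq_zero.mp h2).resolve_left (sub_ne_zero.mpr hik), zero_mul, mul_zero]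

lemma mul_transpose_mul_diagonal_inv_mul (hW : W * Wᵀ * W = diagonal b * W) :
    W * (Wᵀ * diagonal b⁻¹ * W) = W := by
  rw [← Matrix.mul_assoc, ← Matrix.mul_assoc, gram_mul_diagonal_inv hW, Matrix.mul_assoc, hW,
    diagonal_inv_mul_diagonal_mul hW]

lemma compl_transpose_mul_self [DecidableEq κ] (hW : W * Wᵀ * W = diagonal b * W) :
    (1 - Wᵀ * diagonal b⁻¹ * W) * (1 - Wᵀ * diagonal b⁻¹ * W)ᵀ =
      1 - Wᵀ * diagonal b⁻¹ * W := by
  have h : (Wᵀ * diagonal b⁻¹ * W)ᵀ = Wᵀ * diagonal b⁻¹ * W := by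
    simp only [transpose_mul, transpose_transpose, diagonal_transpose, Matrix.mul_assoc]
  have h2 : Wᵀ * diagonal b⁻¹ * W * (Wᵀ * diagonal b⁻¹ * W) = Wᵀ * diagonal b⁻¹ * W := by
    rw [Matrix.mul_assoc _ W, mul_transpose_mul_diagonal_inv_mul hW]
  rw [transpose_sub, transpose_one, h, Matrix.sub_mul, Matrix.mul_sub, Matrix.mul_sub, h2]
  simp

lemma trace_transpose_mul_diagonal_inv_mul :
    trace (Wᵀ * diagonal b⁻¹ * W) = ∑ i, (b i)⁻¹ * (W * Wᵀ) i i := by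
  rw [Matrix.mul_assoc, trace_mul_comm, Matrix.mul_assoc, trace]
  simp only [diag_apply, diagonal_mul, Pi.inv_apply]

lemma sum_weights_le [DecidableEq κ] (hW : W * Wᵀ * W = diagonal b * W) :
    ∑ i, (b i)⁻¹ * (W * Wᵀ) i i ≤ Fintype.card κ := by
  have h := trace_mul_transpose_self_nonneg (1 - Wᵀ * diagonal b⁻¹ * W)
  rw [compl_transpose_mul_self hW, trace_sub, trace_one,
    trace_transpose_mul_diagonal_inv_mul] at h
  linarith

/-- If the weights do not have full mass, then `W` has a nontrivial kernel. -/
lemma exists_mulVec_eq_zero_of_sum_weights_ne [DecidableEq κ]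
    (hW : W * Wᵀ * W = diagonal b * W)
    (h : ∑ i, (b i)⁻¹ * (W * Wᵀ) i i ≠ Fintype.card κ) : ∃ u, u ≠ 0 ∧ W *ᵥ u = 0 := by
  have h1 : 1 - Wᵀ * diagonal b⁻¹ * W ≠ 0 := by
    intro h0
    have h2 := congrArg trace h0
    rw [trace_sub, trace_one, trace_transpose_mul_diagonal_inv_mul, trace_zero] at h2
    exact h (by linarith)
  have h2 : W * (1 - Wᵀ * diagonal b⁻¹ * W) = 0 := by
    rw [Matrix.mul_sub, mul_transpose_mul_diagonal_inv_mul hW, Matrix.mul_one, sub_self]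
  by_contra! hc
  apply h1
  have h3 : ∀ v, (1 - Wᵀ * diagonal b⁻¹ * W) *ᵥ v = 0 := by
    intro v
    by_contra hv
    exact hc _ hv (by rw [mulVec_mulVec, h2, zero_mulVec])
  exact mulVec_injective (funext fun v => by rw [h3, zero_mulVec])

lemma weight_nonneg (hW : W * Wᵀ * W = diagonal b * W) (i : ι) :
    0 ≤ (b i)⁻¹ * (W * Wᵀ) i i := by
  rcases le_or_gt (b i) 0 with hi | hi
  · rw [gram_diag_eq_zero hW hi, mul_zero]
  · exact mul_nonneg (inv_nonneg.mpr hi.le) (mul_transpose_self_diag_nonneg W i)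

lemma weight_le_one (hW : W * Wᵀ * W = diagonal b * W) (i : ι) :
    (b i)⁻¹ * (W * Wᵀ) i i ≤ 1 := by
  rcases le_or_gt (b i) 0 with hi | hi
  · rw [gram_diag_eq_zero hW hi, mul_zero]; exact zero_le_one
  · rw [inv_mul_le_one₀ hi]
    by_contra! h
    nlinarith [gram_diag_sq_le hW i]

lemma trace_gram_sq (hW : W * Wᵀ * W = diagonal b * W) :
    trace (W * Wᵀ * (W * Wᵀ)) = ∑ i, b i ^ 2 * ((b i)⁻¹ * (W * Wᵀ) i i) := by
  rw [gram_sq hW, trace]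
  simp only [diag_apply, diagonal_mul, mul_gram_diag]

lemma compl_weight_inequality (hW : W * Wᵀ * W = diagonal b * W)
    (hvec : ∀ (w : ι → ℝ) (u : κ → ℝ), Wᵀ *ᵥ w = 0 →
      (w ⬝ᵥ diagonal b *ᵥ w) * (u ⬝ᵥ u) ≤ (w ⬝ᵥ w) * ((W *ᵥ u) ⬝ᵥ (W *ᵥ u)))
    (i : ι) (u : κ → ℝ) :
    (1 - (b i)⁻¹ * (W * Wᵀ) i i) * b i * (u ⬝ᵥ u) ≤
      (1 - (b i)⁻¹ * (W * Wᵀ) i i) * ((W *ᵥ u) ⬝ᵥ (W *ᵥ u)) := by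
  obtain ⟨T, hT⟩ : ∃ T, T = 1 - diagonal b⁻¹ * (W * Wᵀ) := ⟨_, rfl⟩
  have hTt : Tᵀ = T := by
    rw [hT, transpose_sub, transpose_one, transpose_mul, diagonal_transpose, transpose_mul,
      transpose_transpose, gram_mul_diagonal_inv hW]
  have hWT : Wᵀ * T = 0 := by
    have h : T * W = 0 := by
      rw [hT, Matrix.sub_mul, Matrix.one_mul, Matrix.mul_assoc, hW,
        diagonal_inv_mul_diagonal_mul hW, sub_self]
    have h2 := congrArg transpose h
    rwa [transpose_mul, hTt, transpose_zero] at h2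
  have hTT : T * T = T := by
    conv_lhs => enter [1]; rw [hT]
    rw [Matrix.sub_mul, Matrix.one_mul, Matrix.mul_assoc, Matrix.mul_assoc W, hWT]
    simp
  have hTB : T * diagonal b = diagonal b * T := by
    rw [hT, Matrix.sub_mul, Matrix.mul_sub, Matrix.mul_assoc, gram_mul_diagonal hW,
      ← Matrix.mul_assoc, (commute_diagonal b⁻¹ b).eq, Matrix.one_mul, Matrix.mul_one,
      Matrix.mul_assoc (diagonal b)]
  have hTi : T i i = 1 - (b i)⁻¹ * (W * Wᵀ) i i := by
    rw [hT, Matrix.sub_apply, one_apply_eq, diagonal_mul, Pi.inv_apply]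
  have hquad : ∀ N : Matrix ι ι ℝ, (T *ᵥ Pi.single i 1) ⬝ᵥ N *ᵥ (T *ᵥ Pi.single i 1) =
      (T * (N * T)) i i := by
    intro N
    rw [mulVec_mulVec, dotProduct_mulVec, ← vecMul_transpose, hTt, vecMul_vecMul,
      ← dotProduct_mulVec, mulVec_single_one, single_one_dotProduct, col_apply]
  have h := hvec (T *ᵥ Pi.single i 1) u (by rw [mulVec_mulVec, hWT, zero_mulVec])
  have h1 := hquad 1
  rw [one_mulVec, Matrix.one_mul, hTT, hTi] at h1
  rw [hquad, h1, ← Matrix.mul_assoc, hTB, Matrix.mul_assoc, hTT, diagonal_mul, hTi,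
    mul_comm (b i)] at h
  exact h

end Weights

lemma sum_sq_mul_weights_le {ι : Type*} [Fintype ι] [DecidableEq ι] {S : Finset ι}
    {b q : ι → ℝ} {c : ℝ} (hc : 0 ≤ c) (hS : ∀ i ∈ S, c ≤ b i) (hS' : ∀ i ∉ S, b i ≤ c)
    (hq0 : ∀ i, 0 ≤ q i) (hq1 : ∀ i, q i ≤ 1) (hqb : ∀ i, b i ≤ 0 → q i = 0)
    (hsum : ∑ i, q i ≤ S.card) : ∑ i, b i ^ 2 * q i ≤ ∑ i ∈ S, b i ^ 2 := by
  have h1 : ∀ i, (b i ^ 2 - c ^ 2) * q i ≤ if i ∈ S then b i ^ 2 - c ^ 2 else 0 := by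
    intro i
    split_ifs with hi
    · have : c ^ 2 ≤ b i ^ 2 := pow_le_pow_left₀ hc (hS i hi) 2
      nlinarith [hq1 i]
    · rcases le_or_gt (b i) 0 with hb | hb
      · rw [hqb i hb, mul_zero]
      · have : b i ^ 2 ≤ c ^ 2 := pow_le_pow_left₀ hb.le (hS' i hi) 2
        nlinarith [hq0 i]
  have h2 := Finset.sum_le_sum fun i (_ : i ∈ Finset.univ) => h1 i
  rw [Finset.sum_ite_mem, Finset.univ_inter, Finset.sum_sub_distrib, Finset.sum_const,
    nsmul_eq_mul] at h2
  simp_rw [sub_mul] at h2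
  rw [Finset.sum_sub_distrib, ← Finset.mul_sum] at h2
  nlinarith [mul_le_mul_of_nonneg_left hsum (sq_nonneg c)]

lemma le_sum_sq_mul_weights {ι : Type*} [Fintype ι] [DecidableEq ι] {S : Finset ι}
    {b q : ι → ℝ} (hq0 : ∀ i, 0 ≤ q i) (hq1 : ∀ i, q i ≤ 1) (hsum : ∑ i, q i = S.card)
    (hex : ∀ i ∈ S, ∀ k ∉ S, (1 - q i) * q k * b i ^ 2 ≤ (1 - q i) * q k * b k ^ 2) :
    ∑ i ∈ S, b i ^ 2 ≤ ∑ i, b i ^ 2 * q i := by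
  rw [← Finset.sum_add_sum_compl S] at hsum ⊢
  have hs : ∑ i ∈ S, (1 - q i) = ∑ k ∈ Sᶜ, q k := by
    rw [Finset.sum_sub_distrib, Finset.sum_const, nsmul_eq_mul, mul_one]; linarith
  have hmain : ∑ i ∈ S, (1 - q i) * b i ^ 2 ≤ ∑ k ∈ Sᶜ, b k ^ 2 * q k := by
    have h0 : 0 ≤ ∑ k ∈ Sᶜ, q k := Finset.sum_nonneg fun k _ => hq0 k
    rcases h0.eq_or_lt with h | h
    · rw [← h] at hs
      have h2 := (Finset.sum_eq_zero_iff_of_nonneg fun i _ => sub_nonneg.mpr (hq1 i)).mp hs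
      rw [Finset.sum_eq_zero fun i hi => by rw [h2 i hi, zero_mul]]
      exact Finset.sum_nonneg fun k _ => mul_nonneg (sq_nonneg _) (hq0 k)
    · refine le_of_mul_le_mul_left ?_ h
      conv_rhs => rw [← hs]
      rw [mul_comm, Finset.sum_mul_sum, Finset.sum_mul_sum]
      refine Finset.sum_le_sum fun i hi => Finset.sum_le_sum fun k hk => ?_
      linarith [hex i hi k (Finset.mem_compl.mp hk)]
  have hsplit : ∑ i ∈ S, b i ^ 2 = ∑ i ∈ S, b i ^ 2 * q i + ∑ i ∈ S, (1 - q i) * b i ^ 2 := by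
    rw [← Finset.sum_add_distrib]
    exact Finset.sum_congr rfl fun i _ => by ring
  linarith

lemma gradPen_mul_symplectic {n p : ℕ} {A S : Matrix (Fin n ⊕ Fin n) (Fin n ⊕ Fin n) ℝ}
    (hS : Sᵀ * Jmat n * S = Jmat n) (β : ℝ) (W : Matrix (Fin n ⊕ Fin n) (Fin p ⊕ Fin p) ℝ) :
    Sᵀ * gradPen n p A β (S * W) = gradPen n p (Sᵀ * A * S) β W := by
  have h : ∀ Z : Matrix (Fin n ⊕ Fin n) (Fin p ⊕ Fin p) ℝ,
      Sᵀ * (Jmat n * (S * Z)) = Jmat n * Z := fun Z => by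
    rw [← Matrix.mul_assoc, ← Matrix.mul_assoc, hS]
  simp only [gradPen, transpose_mul, Matrix.mul_sub, Matrix.mul_smul, Matrix.mul_assoc, h]

lemma fPen_mul_symplectic {n p : ℕ} {A S : Matrix (Fin n ⊕ Fin n) (Fin n ⊕ Fin n) ℝ}
    (hS : Sᵀ * Jmat n * S = Jmat n) (β : ℝ) (W : Matrix (Fin n ⊕ Fin n) (Fin p ⊕ Fin p) ℝ) :
    fPen n p A β (S * W) = fPen n p (Sᵀ * A * S) β W := by
  have h : ∀ Z : Matrix (Fin n ⊕ Fin n) (Fin p ⊕ Fin p) ℝ,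
      Sᵀ * (Jmat n * (S * Z)) = Jmat n * Z := fun Z => by
    rw [← Matrix.mul_assoc, ← Matrix.mul_assoc, hS]
  simp only [fPen, transpose_mul, Matrix.mul_assoc, h]

lemma symplectic_mul_inverse {n : ℕ} {S : Matrix (Fin n ⊕ Fin n) (Fin n ⊕ Fin n) ℝ}
    (hS : Sᵀ * Jmat n * S = Jmat n) : S * (-(Jmat n * Sᵀ * Jmat n)) = 1 := by
  rw [mul_eq_one_comm, Matrix.neg_mul, Matrix.mul_assoc, Matrix.mul_assoc, ← Matrix.mul_assoc Sᵀ,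
    hS, Jmat_mul_self, neg_neg]

/-- The minimization result for a diagonal matrix in Williamson normal form. -/
lemma isMin_of_second_order_diagonal {n p : ℕ} {d : Fin n → ℝ} {m : Fin n} (hm : (m : ℕ) + 1 = p)
    (hmono : Monotone d) (hdpos : ∀ i, 0 < d i) {β : ℝ} (hβ : d m < β)
    {W : Matrix (Fin n ⊕ Fin n) (Fin p ⊕ Fin p) ℝ}
    (hstat : gradPen n p (diagonal (Sum.elim d d)) β W = 0)
    (hhess : ∀ Y : Matrix (Fin n ⊕ Fin n) (Fin p ⊕ Fin p) ℝ,
      0 ≤ trace (Yᵀ * diagonal (Sum.elim d d) * Y)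
          - β * trace ((Yᵀ * Jmat n * Y) * (Wᵀ * Jmat n * W - Jmat p))
          + (β / 2) * frobSq (Yᵀ * Jmat n * W + Wᵀ * Jmat n * Y))
    (Y : Matrix (Fin n ⊕ Fin n) (Fin p ⊕ Fin p) ℝ) :
    fPen n p (diagonal (Sum.elim d d)) β W ≤ fPen n p (diagonal (Sum.elim d d)) β Y := by
  have hβ0 : 0 < β := (hdpos _).trans hβ
  have he : ∀ i, 0 < Sum.elim d d i := by rintro (i | i) <;> exact hdpos i
  obtain ⟨b, hb⟩ : ∃ b : Fin n → ℝ, b = fun i => 1 - d i / β := ⟨_, rfl⟩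
  have hD : diagonal (Sum.elim d d) = β • (1 - diagonal (Sum.elim b b)) := by
    rw [← diagonal_one, diagonal_sub, ← diagonal_smul, hb]
    congr 1
    ext (i | i) <;> simp [mul_div_cancel₀, hβ0.ne']
  have hstruct : ∀ Z : Matrix (Fin n ⊕ Fin n) (Fin p ⊕ Fin p) ℝ,
      gradPen n p (diagonal (Sum.elim d d)) β Z = 0 → Jmat n * Z = Z * Jmat p ∧
        Z * Zᵀ * Z = diagonal (Sum.elim b b) * Z ∧
        fPen n p (diagonal (Sum.elim d d)) β Z =
          β / 4 * (2 * p - ∑ i, Sum.elim b b i ^ 2 * ((Sum.elim b b i)⁻¹ * (Z * Zᵀ) i i)) := by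
    intro Z hZ
    obtain ⟨h1, h2⟩ := critical_point_structure (Jmat_transpose n) (Jmat_mul_self n)
      (Jmat_transpose p) (Jmat_mul_self p) he (diagonal_mul_Jmat d) hβ0 (sub_eq_zero.mp hZ)
    have h3 : Z * Zᵀ * Z = diagonal (Sum.elim b b) * Z := by
      have h4 := h2
      rw [hD, Matrix.smul_mul, Matrix.sub_mul, Matrix.one_mul] at h4
      exact (sub_right_injective (smul_right_injective _ hβ0.ne' h4)).symm
    exact ⟨h1, h3, by rw [fPen_eq_of_structure h1 h2, trace_gram_sq h3]⟩
  obtain ⟨Z, hZ⟩ := exists_isMin_fPen (p := p) he hβ0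
  refine le_trans ?_ (hZ Y)
  obtain ⟨-, hZW, hZf⟩ := hstruct Z (gradPen_eq_zero_of_isMin (diagonal_transpose _) hZ)
  obtain ⟨hJW, hWW, hWf⟩ := hstruct W hstat
  obtain ⟨T, hT⟩ : ∃ T : Finset (Fin n), T = Finset.univ.filter fun i : Fin n => (i : ℕ) < p := ⟨_, rfl⟩
  obtain ⟨S, hS⟩ : ∃ S : Finset (Fin n ⊕ Fin n), S = T.disjSum T := ⟨_, rfl⟩
  have hcard : (S.card : ℝ) = Fintype.card (Fin p ⊕ Fin p) := by
    rw [hS, Finset.card_disjSum, hT, Fin.card_filter_val_lt, min_eq_right (by omega),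
      Fintype.card_sum, Fintype.card_fin]
  have hc : 0 < b m := by
    rw [hb]; exact sub_pos.mpr ((div_lt_one hβ0).mpr hβ)
  have hanti : Antitone b := by
    rw [hb]
    intro i j hij
    have := hmono hij
    dsimp only
    gcongr
  have hmemS : ∀ i ∈ S, b m ≤ Sum.elim b b i := by
    rintro (i | i) hi <;>
    · have hi : (i : ℕ) < p := by simpa [hS, hT] using hi
      exact hanti (Fin.le_def.mpr (by omega))
  have hmemS' : ∀ i ∉ S, Sum.elim b b i ≤ b m := by
    rintro (i | i) hi <;>
    · have hi : p ≤ (i : ℕ) := by simpa [hS, hT] using hi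
      exact hanti (Fin.le_def.mpr (by omega))
  have hupper := sum_sq_mul_weights_le hc.le hmemS hmemS' (weight_nonneg hZW) (weight_le_one hZW)
    (fun i hi => by rw [gram_diag_eq_zero hZW hi, mul_zero])
    (by rw [hcard]; exact sum_weights_le hZW)
  have hineq := compl_weight_inequality hWW (second_order_vector_inequality hβ0 hJW
    (diagonal_mul_Jmat b) fun Y => by rw [← hD]; exact hhess Y)
  have hlower : ∑ i ∈ S, Sum.elim b b i ^ 2 ≤
      ∑ i, Sum.elim b b i ^ 2 * ((Sum.elim b b i)⁻¹ * (W * Wᵀ) i i) := by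
    by_cases hsum : ∑ i, (Sum.elim b b i)⁻¹ * (W * Wᵀ) i i = Fintype.card (Fin p ⊕ Fin p)
    · refine le_sum_sq_mul_weights (weight_nonneg hWW) (weight_le_one hWW)
        (hsum.trans hcard.symm) fun i hi k _ => ?_
      have hbi : 0 < Sum.elim b b i := hc.trans_le (hmemS i hi)
      rcases le_or_gt (Sum.elim b b k) 0 with hk | hk
      · rw [gram_diag_eq_zero hWW hk]; simp
      have h := hineq i (Wᵀ *ᵥ Pi.single k 1)
      have h1 : (Wᵀ *ᵥ Pi.single k 1) ⬝ᵥ (Wᵀ *ᵥ Pi.single k 1) = (W * Wᵀ) k k := by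
        rw [dotProduct_mulVec, vecMul_transpose, mulVec_mulVec, mulVec_single_one,
          dotProduct_single_one, col_apply]
      have h2 : (W *ᵥ (Wᵀ *ᵥ Pi.single k 1)) ⬝ᵥ (W *ᵥ (Wᵀ *ᵥ Pi.single k 1)) =
          Sum.elim b b k * (W * Wᵀ) k k := by
        rw [mulVec_mulVec, dotProduct_mulVec, ← mulVec_transpose, mulVec_mulVec, transpose_mul,
          transpose_transpose, gram_sq hWW, mulVec_single_one, dotProduct_single_one, col_apply,
          diagonal_mul]
      rw [h1, h2] at h
      have hq := weight_le_one hWW i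
      have h3 : 0 ≤ (1 - (Sum.elim b b i)⁻¹ * (W * Wᵀ) i i) *
          ((Sum.elim b b k)⁻¹ * (W * Wᵀ) k k) :=
        mul_nonneg (sub_nonneg.mpr hq) (weight_nonneg hWW k)
      rcases h3.eq_or_lt with h3 | h3
      · rw [← h3, zero_mul, zero_mul]
      · refine mul_le_mul_of_nonneg_left (pow_le_pow_left₀ hbi.le ?_ 2) h3.le
        refine le_of_mul_le_mul_left ?_ h3
        calc _ = (Sum.elim b b k)⁻¹ * ((1 - (Sum.elim b b i)⁻¹ * (W * Wᵀ) i i) *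
              Sum.elim b b i * (W * Wᵀ) k k) := by ring
          _ ≤ (Sum.elim b b k)⁻¹ * _ := mul_le_mul_of_nonneg_left h (inv_nonneg.mpr hk.le)
          _ = _ := by ring
    · obtain ⟨u, hu, hWu⟩ := exists_mulVec_eq_zero_of_sum_weights_ne hWW hsum
      have hone : ∀ i ∈ S, (Sum.elim b b i)⁻¹ * (W * Wᵀ) i i = 1 := by
        intro i hi
        have hbi : 0 < Sum.elim b b i := hc.trans_le (hmemS i hi)
        have h := hineq i u
        rw [hWu, dotProduct_zero, mul_zero, mul_assoc] at h
        have huu : 0 < u ⬝ᵥ u :=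
          (Finset.sum_nonneg fun j _ => mul_self_nonneg (u j)).lt_of_ne'
            fun h0 => hu (dotProduct_self_eq_zero.mp h0)
        refine le_antisymm (weight_le_one hWW i) (sub_nonpos.mp ?_)
        exact nonpos_of_mul_nonpos_left h (mul_pos hbi huu)
      calc _ = ∑ i ∈ S, Sum.elim b b i ^ 2 * ((Sum.elim b b i)⁻¹ * (W * Wᵀ) i i) :=
            Finset.sum_congr rfl fun i hi => by rw [hone i hi, mul_one]
        _ ≤ _ := Finset.sum_le_univ_sum_of_nonneg fun i =>
            mul_nonneg (sq_nonneg _) (weight_nonneg hWW i)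
  rw [hWf, hZf]
  exact mul_le_mul_of_nonneg_left (sub_le_sub_left (hupper.trans hlower) _) (by positivity)

theorem stmt7 (n p : ℕ) (hp : 1 ≤ p) (hpn : p ≤ n)
    (A : Matrix (Fin n ⊕ Fin n) (Fin n ⊕ Fin n) ℝ) (hA : A.PosDef)
    (d : Fin n → ℝ) (hmono : Monotone d) (hdpos : ∀ i, 0 < d i)
    (S₀ : Matrix (Fin n ⊕ Fin n) (Fin n ⊕ Fin n) ℝ)
    (hS₀symp : S₀ᵀ * Jmat n * S₀ = Jmat n)
    (hS₀diag : S₀ᵀ * A * S₀ = Matrix.diagonal (Sum.elim d d))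
    (β : ℝ) (hβ : d ⟨p - 1, by omega⟩ < β)
    (X : Matrix (Fin n ⊕ Fin n) (Fin p ⊕ Fin p) ℝ)
    (hstat : gradPen n p A β X = 0)
    (hhess : ∀ Y : Matrix (Fin n ⊕ Fin n) (Fin p ⊕ Fin p) ℝ,
      0 ≤ Matrix.trace (Yᵀ * A * Y)
          - β * Matrix.trace ((Yᵀ * Jmat n * Y) * (Xᵀ * Jmat n * X - Jmat p))
          + (β / 2) * frobSq (Yᵀ * Jmat n * X + Xᵀ * Jmat n * Y)) :
    ∀ Y, fPen n p A β X ≤ fPen n p A β Y := by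
  have hR := symplectic_mul_inverse hS₀symp
  have hsub : ∀ Z : Matrix (Fin n ⊕ Fin n) (Fin p ⊕ Fin p) ℝ,
      Z = S₀ * (-(Jmat n * S₀ᵀ * Jmat n) * Z) := fun Z => by
    rw [← Matrix.mul_assoc, hR, Matrix.one_mul]
  obtain ⟨W, rfl⟩ : ∃ W, X = S₀ * W := ⟨_, hsub X⟩
  intro Y
  obtain ⟨V, rfl⟩ : ∃ V, Y = S₀ * V := ⟨_, hsub Y⟩
  rw [fPen_mul_symplectic hS₀symp, fPen_mul_symplectic hS₀symp, hS₀diag]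
  have hcancel : ∀ Z : Matrix (Fin n ⊕ Fin n) (Fin p ⊕ Fin p) ℝ,
      S₀ᵀ * (Jmat n * (S₀ * Z)) = Jmat n * Z := fun Z => by
    rw [← Matrix.mul_assoc, ← Matrix.mul_assoc, hS₀symp]
  refine isMin_of_second_order_diagonal (Nat.sub_add_cancel hp) hmono hdpos hβ ?_ (fun E => ?_) V
  · rw [← hS₀diag, ← gradPen_mul_symplectic hS₀symp, hstat, Matrix.mul_zero]
  · have h := hhess (S₀ * E)
    rw [← hS₀diag]
    simpa only [transpose_mul, Matrix.mul_assoc, hcancel] using h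
end
end

section
/- Let A ∈ ℝ^{2n×2n} be symmetric positive definite with symplectic eigenvalues 0 < d₁ ≤ … ≤ d_n, let 1 < p ≤ n and β > d_p, and let X = S̄(I_{2p} − D̄/β)^{1/2}Tᵀ be a global minimizer of f_β, where S̄ ∈ Sp(2p,2n) satisfies S̄ᵀAS̄ = D̄ = Diag(d₁,…,d_p,d₁,…,d_p) and T ∈ OrSp(2p). Then there exists Y ∈ ℝ^{2n×2p} with tr(YᵀY) = 1 such that the Hessian quadratic form H(Y) := tr(YᵀAY) − β·tr((YᵀJ_nY)(XᵀJ_nX − J_p)) + (β/2)‖YᵀJ_nX + XᵀJ_nY‖_F² satisfies (σ_min(A)/d_p)·β(1 − d_p/β)² ≤ H(Y) ≤ (σ_max(A)/d_p)·β(1 − d_p/β)², where σ_min(A) and σ_max(A) are the smallest and largest eigenvalues of A. -/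
open Matrix BigOperators

noncomputable section

/-- Lower Rayleigh bound for a real symmetric matrix. -/
lemma iInf_eigenvalues_mul_dotProduct_le {ι : Type*} [Fintype ι] [DecidableEq ι]
    {A : Matrix ι ι ℝ} (hA : A.IsHermitian) (v : ι → ℝ) :
    (⨅ i, hA.eigenvalues i) * (v ⬝ᵥ v) ≤ v ⬝ᵥ A *ᵥ v := by
  have h : (A - (⨅ i, hA.eigenvalues i) • (1 : Matrix ι ι ℝ)).PosSemidef := by
    have hD : (Matrix.diagonal fun i => hA.eigenvalues i - ⨅ i, hA.eigenvalues i).PosSemidef :=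
      Matrix.PosSemidef.diagonal fun i => sub_nonneg.2 (ciInf_le (Set.finite_range _).bddBelow i)
    have hU := hD.mul_mul_conjTranspose_same (hA.eigenvectorUnitary : Matrix ι ι ℝ)
    convert hU using 1
    have hs := hA.spectral_theorem
    rw [Unitary.conjStarAlgAut_apply] at hs
    have hone : (hA.eigenvectorUnitary : Matrix ι ι ℝ) *
        (hA.eigenvectorUnitary : Matrix ι ι ℝ)ᴴ = 1 :=
      Unitary.mul_star_self_of_mem hA.eigenvectorUnitary.2
    have hdiag : (Matrix.diagonal fun i => hA.eigenvalues i - ⨅ i, hA.eigenvalues i) =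
        Matrix.diagonal hA.eigenvalues - (⨅ i, hA.eigenvalues i) • (1 : Matrix ι ι ℝ) := by
      rw [Matrix.smul_one_eq_diagonal, Matrix.diagonal_sub]
    rw [hdiag, mul_sub, sub_mul, mul_smul_comm, mul_one, smul_mul_assoc, hone]
    congr 1
  have := h.dotProduct_mulVec_nonneg v
  simp only [star_trivial, Matrix.sub_mulVec, Matrix.smul_mulVec, Matrix.one_mulVec,
    dotProduct_sub, dotProduct_smul, smul_eq_mul] at this
  linarith

/-- Upper Rayleigh bound for a real symmetric matrix. -/
lemma dotProduct_mulVec_le_iSup_eigenvalues_mul {ι : Type*} [Fintype ι] [DecidableEq ι]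
    {A : Matrix ι ι ℝ} (hA : A.IsHermitian) (v : ι → ℝ) :
    v ⬝ᵥ A *ᵥ v ≤ (⨆ i, hA.eigenvalues i) * (v ⬝ᵥ v) := by
  have h : ((⨆ i, hA.eigenvalues i) • (1 : Matrix ι ι ℝ) - A).PosSemidef := by
    have hD : (Matrix.diagonal fun i => (⨆ i, hA.eigenvalues i) - hA.eigenvalues i).PosSemidef :=
      Matrix.PosSemidef.diagonal fun i => sub_nonneg.2 (le_ciSup (Set.finite_range _).bddAbove i)
    have hU := hD.mul_mul_conjTranspose_same (hA.eigenvectorUnitary : Matrix ι ι ℝ)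
    convert hU using 1
    have hs := hA.spectral_theorem
    rw [Unitary.conjStarAlgAut_apply] at hs
    have hone : (hA.eigenvectorUnitary : Matrix ι ι ℝ) *
        (hA.eigenvectorUnitary : Matrix ι ι ℝ)ᴴ = 1 :=
      Unitary.mul_star_self_of_mem hA.eigenvectorUnitary.2
    have hdiag : (Matrix.diagonal fun i => (⨆ i, hA.eigenvalues i) - hA.eigenvalues i) =
        (⨆ i, hA.eigenvalues i) • (1 : Matrix ι ι ℝ) - Matrix.diagonal hA.eigenvalues := by
      rw [Matrix.smul_one_eq_diagonal, Matrix.diagonal_sub]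
    rw [hdiag, mul_sub, sub_mul, mul_smul_comm, mul_one, smul_mul_assoc, hone]
    congr 1
  have := h.dotProduct_mulVec_nonneg v
  simp only [star_trivial, Matrix.sub_mulVec, Matrix.smul_mulVec, Matrix.one_mulVec,
    dotProduct_sub, dotProduct_smul, smul_eq_mul] at this
  linarith

lemma Jmat_mul_diagonal {k : ℕ} (u : Fin k → ℝ) :
    Jmat k * Matrix.diagonal (Sum.elim u u) = Matrix.diagonal (Sum.elim u u) * Jmat k := by
  simp [Jmat, ← Matrix.fromBlocks_diagonal, Matrix.fromBlocks_multiply]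

/-- An orthogonal symplectic matrix commutes with the Poisson matrix under conjugation. -/
lemma mul_Jmat_mul_transpose {k : ℕ} {T : Matrix (Fin k ⊕ Fin k) (Fin k ⊕ Fin k) ℝ}
    (hs : Tᵀ * Jmat k * T = Jmat k) (ho : Tᵀ * T = 1) : T * Jmat k * Tᵀ = Jmat k := by
  have h := mul_eq_one_comm.1 ho
  calc T * Jmat k * Tᵀ = (T * Tᵀ) * Jmat k * (T * Tᵀ) := by
        nth_rewrite 1 [← hs]; simp only [Matrix.mul_assoc]
    _ = Jmat k := by rw [h]; simp

lemma trace_conj_of_orthogonal {ι : Type*} [Fintype ι] [DecidableEq ι] {T : Matrix ι ι ℝ}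
    (h : Tᵀ * T = 1) (M : Matrix ι ι ℝ) : Matrix.trace (T * M * Tᵀ) = Matrix.trace M := by
  rw [Matrix.trace_mul_comm, ← Matrix.mul_assoc, h, Matrix.one_mul]

lemma frobSq_conj_of_orthogonal {ι : Type*} [Fintype ι] [DecidableEq ι] {T : Matrix ι ι ℝ}
    (h : Tᵀ * T = 1) (M : Matrix ι ι ℝ) : frobSq (T * M * Tᵀ) = frobSq M := by
  have : (T * M * Tᵀ)ᵀ * (T * M * Tᵀ) = T * (Mᵀ * M) * Tᵀ := by
    calc (T * M * Tᵀ)ᵀ * (T * M * Tᵀ) = T * Mᵀ * (Tᵀ * T) * M * Tᵀ := by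
          simp only [Matrix.transpose_mul, Matrix.transpose_transpose, Matrix.mul_assoc]
      _ = _ := by rw [h]; simp only [Matrix.mul_one, Matrix.mul_assoc]
  rw [frobSq, this, trace_conj_of_orthogonal h, frobSq]

/-- The projection of `ℝ^{2k}` onto the `q`-th symplectic coordinate plane. -/
def planeProj {k : ℕ} (q : Fin k) : Matrix (Fin k ⊕ Fin k) (Fin k ⊕ Fin k) ℝ :=
  Matrix.diagonal (Sum.elim (Pi.single q 1) (Pi.single q 1))

section planeProj

variable {k : ℕ} (q : Fin k)

lemma planeProj_transpose : (planeProj q)ᵀ = planeProj q := Matrix.diagonal_transpose _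

lemma planeProj_mul_diagonal (u : Fin k → ℝ) :
    planeProj q * Matrix.diagonal (Sum.elim u u) = u q • planeProj q := by
  rw [planeProj, Matrix.diagonal_mul_diagonal, ← Matrix.diagonal_smul]
  congr 1
  ext (i | i) <;> by_cases h : i = q <;> simp [h]

lemma diagonal_mul_planeProj (u : Fin k → ℝ) :
    Matrix.diagonal (Sum.elim u u) * planeProj q = u q • planeProj q := by
  rw [← planeProj_mul_diagonal, planeProj, Matrix.diagonal_mul_diagonal,
    Matrix.diagonal_mul_diagonal]
  simp only [mul_comm]

lemma planeProj_mul_self : planeProj q * planeProj q = planeProj q := by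
  conv_lhs => rhs; rw [planeProj]
  rw [planeProj_mul_diagonal]; simp

lemma Jmat_mul_planeProj : Jmat k * planeProj q = planeProj q * Jmat k := Jmat_mul_diagonal _

lemma trace_mul_planeProj (G : Matrix (Fin k ⊕ Fin k) (Fin k ⊕ Fin k) ℝ) :
    Matrix.trace (G * planeProj q) = G (.inl q) (.inl q) + G (.inr q) (.inr q) := by
  simp [Matrix.trace, planeProj, Matrix.mul_diagonal, Pi.single_apply]

lemma trace_planeProj : Matrix.trace (planeProj q) = 2 := by
  rw [← Matrix.one_mul (planeProj q), trace_mul_planeProj]; norm_num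

/-- The rotation-scaling `a + bJ` of the `q`-th symplectic coordinate plane. -/
def planeRot (a b : ℝ) : Matrix (Fin k ⊕ Fin k) (Fin k ⊕ Fin k) ℝ :=
  a • planeProj q + b • (planeProj q * Jmat k)

variable (a b : ℝ)

lemma planeRot_transpose : (planeRot q a b)ᵀ = planeRot q a (-b) := by
  simp [planeRot, planeProj_transpose, Jmat_transpose, Jmat_mul_planeProj]

lemma Jmat_mul_planeRot : Jmat k * planeRot q a b = planeRot q a b * Jmat k := by
  simp only [planeRot, mul_add, add_mul, mul_smul_comm, smul_mul_assoc, ← mul_assoc,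
    Jmat_mul_planeProj]

lemma diagonal_mul_planeRot (u : Fin k → ℝ) :
    Matrix.diagonal (Sum.elim u u) * planeRot q a b = u q • planeRot q a b := by
  simp only [planeRot, mul_add, mul_smul_comm, ← mul_assoc, diagonal_mul_planeProj,
    smul_mul_assoc, smul_add, smul_comm (u q)]

lemma planeRot_mul_diagonal (u : Fin k → ℝ) :
    planeRot q a b * Matrix.diagonal (Sum.elim u u) = u q • planeRot q a b := by
  simp only [planeRot, add_mul, smul_mul_assoc, mul_assoc, Jmat_mul_diagonal]
  simp only [← mul_assoc, planeProj_mul_diagonal, smul_mul_assoc, smul_add, smul_comm (u q)]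

lemma planeRot_mul_planeRot_neg :
    planeRot q a b * planeRot q a (-b) = (a ^ 2 + b ^ 2) • planeProj q := by
  have h1 : planeProj q * (planeProj q * Jmat k) = planeProj q * Jmat k := by
    rw [← mul_assoc, planeProj_mul_self]
  have h2 : planeProj q * Jmat k * planeProj q = planeProj q * Jmat k := by
    rw [mul_assoc, Jmat_mul_planeProj, h1]
  have h3 : planeProj q * Jmat k * (planeProj q * Jmat k) = -planeProj q := by
    rw [← mul_assoc, h2, mul_assoc, Jmat_mul_self, mul_neg, mul_one]
  simp only [planeRot, add_mul, mul_add, smul_mul_assoc, mul_smul_comm, planeProj_mul_self,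
    h1, h2, h3]
  module

lemma planeRot_neg_mul_planeRot :
    planeRot q a (-b) * planeRot q a b = (a ^ 2 + b ^ 2) • planeProj q := by
  simpa using planeRot_mul_planeRot_neg q a (-b)

end planeProj

/-- The Hessian quadratic form of `fPen` at a critical point `S Σ Tᵀ`, in the direction of a
rotation-scaling `a + bJ` of one symplectic eigenplane. -/
lemma hessian_planeRot {n p : ℕ} {A : Matrix (Fin n ⊕ Fin n) (Fin n ⊕ Fin n) ℝ} {u s : Fin p → ℝ}
    {β : ℝ} (hβ : β ≠ 0) (hs : ∀ i, s i * s i = 1 - u i / β)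
    {S : Matrix (Fin n ⊕ Fin n) (Fin p ⊕ Fin p) ℝ}
    {T : Matrix (Fin p ⊕ Fin p) (Fin p ⊕ Fin p) ℝ}
    (hSsymp : Sᵀ * Jmat n * S = Jmat p)
    (hSdiag : Sᵀ * A * S = Matrix.diagonal (Sum.elim u u))
    (hTsymp : Tᵀ * Jmat p * T = Jmat p) (hTorth : Tᵀ * T = 1)
    {X Y : Matrix (Fin n ⊕ Fin n) (Fin p ⊕ Fin p) ℝ} (q : Fin p) (a b : ℝ)
    (hX : X = S * Matrix.diagonal (Sum.elim s s) * Tᵀ) (hY : Y = S * planeRot q a b * Tᵀ) :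
    Matrix.trace (Yᵀ * A * Y)
        - β * Matrix.trace ((Yᵀ * Jmat n * Y) * (Xᵀ * Jmat n * X - Jmat p))
        + (β / 2) * frobSq (Yᵀ * Jmat n * X + Xᵀ * Jmat n * Y) =
      4 * a ^ 2 * β * (1 - u q / β) := by
  have hconj : ∀ (B : Matrix (Fin n ⊕ Fin n) (Fin n ⊕ Fin n) ℝ)
      (M N : Matrix (Fin p ⊕ Fin p) (Fin p ⊕ Fin p) ℝ),
      (S * M * Tᵀ)ᵀ * B * (S * N * Tᵀ) = T * (Mᵀ * (Sᵀ * B * S) * N) * Tᵀ := fun B M N => by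
    simp only [Matrix.transpose_mul, Matrix.transpose_transpose, Matrix.mul_assoc]
  have hDt : (Matrix.diagonal (Sum.elim s s))ᵀ = Matrix.diagonal (Sum.elim s s) :=
    Matrix.diagonal_transpose _
  have hYAY : Yᵀ * A * Y = T * ((u q * (a ^ 2 + b ^ 2)) • planeProj q) * Tᵀ := by
    rw [hY, hconj, hSdiag, planeRot_transpose, planeRot_mul_diagonal, smul_mul_assoc,
      planeRot_neg_mul_planeRot, smul_smul]
  have hYJY : Yᵀ * Jmat n * Y = T * ((a ^ 2 + b ^ 2) • (planeProj q * Jmat p)) * Tᵀ := by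
    rw [hY, hconj, hSsymp, planeRot_transpose, mul_assoc (planeRot q a (-b)), Jmat_mul_planeRot,
      ← mul_assoc (planeRot q a (-b)), planeRot_neg_mul_planeRot, smul_mul_assoc]
  have hXJX : Xᵀ * Jmat n * X - Jmat p =
      T * (Jmat p * Matrix.diagonal (Sum.elim (fun i => -(u i / β)) fun i => -(u i / β))) * Tᵀ := by
    have hd : (Matrix.diagonal (Sum.elim s s) * Matrix.diagonal (Sum.elim s s) :
        Matrix (Fin p ⊕ Fin p) (Fin p ⊕ Fin p) ℝ) = 1 +
        Matrix.diagonal (Sum.elim (fun i => -(u i / β)) fun i => -(u i / β)) := by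
      rw [Matrix.diagonal_mul_diagonal, ← Matrix.diagonal_one, Matrix.diagonal_add]
      congr 1
      ext (i | i) <;> simp [hs, sub_eq_add_neg]
    rw [hX, hconj, hSsymp, hDt, ← Jmat_mul_diagonal, mul_assoc (Jmat p), hd, mul_add, mul_one,
      mul_add, add_mul, mul_Jmat_mul_transpose hTsymp hTorth]
    abel
  have hcross : Yᵀ * Jmat n * X + Xᵀ * Jmat n * Y =
      T * ((2 * a * s q) • (planeProj q * Jmat p)) * Tᵀ := by
    rw [hX, hY, hconj, hconj, hSsymp, hDt, planeRot_transpose, mul_assoc (planeRot q a (-b)),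
      Jmat_mul_diagonal, ← mul_assoc (planeRot q a (-b)), planeRot_mul_diagonal,
      mul_assoc _ (Jmat p), Jmat_mul_planeRot,
      ← mul_assoc (Matrix.diagonal _) _ (Jmat p), diagonal_mul_planeRot,
      ← add_mul, ← mul_add, ← add_mul, ← smul_add]
    congr 2
    rw [← smul_mul_assoc]
    congr 1
    simp only [planeRot]
    module
  have hprod : (Yᵀ * Jmat n * Y) * (Xᵀ * Jmat n * X - Jmat p) =
      T * (((a ^ 2 + b ^ 2) * (u q / β)) • planeProj q) * Tᵀ := by
    rw [hYJY, hXJX]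
    calc _ = T * ((a ^ 2 + b ^ 2) • (planeProj q * Jmat p)) * (Tᵀ * T) * (Jmat p *
            Matrix.diagonal (Sum.elim (fun i => -(u i / β)) fun i => -(u i / β))) * Tᵀ := by
          simp only [Matrix.mul_assoc]
      _ = T * ((a ^ 2 + b ^ 2) • (planeProj q * (Jmat p * Jmat p) *
            Matrix.diagonal (Sum.elim (fun i => -(u i / β)) fun i => -(u i / β)))) * Tᵀ := by
          rw [hTorth]; simp only [Matrix.mul_one, Matrix.mul_assoc, smul_mul_assoc]
      _ = _ := by
          rw [Jmat_mul_self, mul_neg, mul_one, neg_mul, planeProj_mul_diagonal, neg_smul, neg_neg,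
            smul_smul]
  have hfrob : frobSq (planeProj q * Jmat p) = 2 := by
    rw [frobSq, Matrix.transpose_mul, planeProj_transpose, Jmat_transpose, mul_assoc,
      ← mul_assoc (planeProj q), planeProj_mul_self, ← Jmat_mul_planeProj, ← mul_assoc,
      neg_mul, Jmat_mul_self, neg_neg, one_mul, trace_planeProj]
  have hfrob_smul : frobSq ((2 * a * s q) • (planeProj q * Jmat p)) = (2 * a * s q) ^ 2 * 2 := by
    rw [← hfrob, frobSq, frobSq, Matrix.transpose_smul, smul_mul_assoc, mul_smul_comm, smul_smul,
      Matrix.trace_smul, smul_eq_mul, sq]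
  rw [hYAY, hprod, hcross, frobSq_conj_of_orthogonal hTorth, trace_conj_of_orthogonal hTorth,
    trace_conj_of_orthogonal hTorth, hfrob_smul, Matrix.trace_smul, Matrix.trace_smul,
    trace_planeProj, mul_pow, sq (s q), hs q]
  simp only [smul_eq_mul]
  field_simp
  ring

theorem stmt11 (n p : ℕ) (h1p : 1 < p) (hpn : p ≤ n)
    (A : Matrix (Fin n ⊕ Fin n) (Fin n ⊕ Fin n) ℝ) (hA : A.PosDef)
    (d : Fin n → ℝ) (hmono : Monotone d) (hdpos : ∀ i, 0 < d i)
    (S₀ : Matrix (Fin n ⊕ Fin n) (Fin n ⊕ Fin n) ℝ)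
    (hS₀symp : S₀ᵀ * Jmat n * S₀ = Jmat n)
    (hS₀diag : S₀ᵀ * A * S₀ = Matrix.diagonal (Sum.elim d d))
    (β : ℝ) (hβ : d ⟨p - 1, by omega⟩ < β)
    (S : Matrix (Fin n ⊕ Fin n) (Fin p ⊕ Fin p) ℝ)
    (T : Matrix (Fin p ⊕ Fin p) (Fin p ⊕ Fin p) ℝ)
    (hSsymp : Sᵀ * Jmat n * S = Jmat p)
    (hSdiag : Sᵀ * A * S =
      Matrix.diagonal (Sum.elim (fun i => d (Fin.castLE hpn i))
        fun i => d (Fin.castLE hpn i)))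
    (hTsymp : Tᵀ * Jmat p * T = Jmat p) (hTorth : Tᵀ * T = 1)
    (X : Matrix (Fin n ⊕ Fin n) (Fin p ⊕ Fin p) ℝ)
    (hX : X = S * Matrix.diagonal
      (Sum.elim (fun i => Real.sqrt (1 - d (Fin.castLE hpn i) / β))
        fun i => Real.sqrt (1 - d (Fin.castLE hpn i) / β)) * Tᵀ)
    (hmin : ∀ Y, fPen n p A β X ≤ fPen n p A β Y) :
    ∃ Y : Matrix (Fin n ⊕ Fin n) (Fin p ⊕ Fin p) ℝ,
      Matrix.trace (Yᵀ * Y) = 1 ∧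
      ((⨅ i, hA.1.eigenvalues i) / d ⟨p - 1, by omega⟩) * (β * (1 - d ⟨p - 1, by omega⟩ / β)^2) ≤
        Matrix.trace (Yᵀ * A * Y)
          - β * Matrix.trace ((Yᵀ * Jmat n * Y) * (Xᵀ * Jmat n * X - Jmat p))
          + (β / 2) * frobSq (Yᵀ * Jmat n * X + Xᵀ * Jmat n * Y) ∧
      Matrix.trace (Yᵀ * A * Y)
          - β * Matrix.trace ((Yᵀ * Jmat n * Y) * (Xᵀ * Jmat n * X - Jmat p))
          + (β / 2) * frobSq (Yᵀ * Jmat n * X + Xᵀ * Jmat n * Y) ≤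
        ((⨆ i, hA.1.eigenvalues i) / d ⟨p - 1, by omega⟩) * (β * (1 - d ⟨p - 1, by omega⟩ / β)^2) := by
  set q : Fin p := ⟨p - 1, by omega⟩ with hq
  set δ := d ⟨p - 1, by omega⟩ with hδ
  have hδpos : 0 < δ := hdpos _
  have hβpos : 0 < β := hδpos.trans hβ
  set x := 1 - δ / β with hx
  have hx0 : 0 < x := sub_pos.2 ((div_lt_one hβpos).2 hβ)
  have hx1 : x < 1 := sub_lt_self _ (div_pos hδpos hβpos)
  have hs : ∀ i : Fin p, Real.sqrt (1 - d (Fin.castLE hpn i) / β) *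
      Real.sqrt (1 - d (Fin.castLE hpn i) / β) = 1 - d (Fin.castLE hpn i) / β := fun i => by
    refine Real.mul_self_sqrt (sub_nonneg.2 ((div_le_one hβpos).2 (le_trans (hmono ?_) hβ.le)))
    rw [Fin.le_def]
    simp only [Fin.val_castLE]
    omega
  have hcol : ∀ j, (S.col j) ⬝ᵥ A *ᵥ (S.col j) = (Sᵀ * A * S) j j := fun j => by
    rw [Matrix.mul_assoc]
    rfl
  have hcol' : ∀ j, (S.col j) ⬝ᵥ (S.col j) = (Sᵀ * S) j j := fun j => rfl
  have hl : (Sᵀ * A * S) (.inl q) (.inl q) = δ := by rw [hSdiag]; simp [hq, hδ]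
  have hr : (Sᵀ * A * S) (.inr q) (.inr q) = δ := by rw [hSdiag]; simp [hq, hδ]
  set N := Matrix.trace (Sᵀ * S * planeProj q) with hN
  rw [trace_mul_planeProj] at hN
  have hlow : (⨅ i, hA.1.eigenvalues i) * N ≤ 2 * δ := by
    have h1 := iInf_eigenvalues_mul_dotProduct_le hA.1 (S.col (.inl q))
    have h2 := iInf_eigenvalues_mul_dotProduct_le hA.1 (S.col (.inr q))
    rw [hcol, hcol', hl] at h1
    rw [hcol, hcol', hr] at h2
    rw [hN, mul_add]; linarith
  have hup : 2 * δ ≤ (⨆ i, hA.1.eigenvalues i) * N := by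
    have h1 := dotProduct_mulVec_le_iSup_eigenvalues_mul hA.1 (S.col (.inl q))
    have h2 := dotProduct_mulVec_le_iSup_eigenvalues_mul hA.1 (S.col (.inr q))
    rw [hcol, hcol', hl] at h1
    rw [hcol, hcol', hr] at h2
    rw [hN, mul_add]; linarith
  have hNpos : 0 < N := by
    have h0 : 0 ≤ N := by
      rw [hN, ← hcol', ← hcol']
      exact add_nonneg (dotProduct_self_star_nonneg _) (dotProduct_self_star_nonneg _)
    refine h0.lt_of_ne fun h => ?_
    rw [← h, mul_zero] at hup
    linarith
  set a := Real.sqrt (x / (2 * N)) with ha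
  set b := Real.sqrt ((1 - x / 2) / N) with hb
  have ha2 : a ^ 2 = x / (2 * N) := Real.sq_sqrt (by positivity)
  have hb2 : b ^ 2 = (1 - x / 2) / N := Real.sq_sqrt (div_nonneg (by linarith) hNpos.le)
  have hH := hessian_planeRot hβpos.ne' hs hSsymp hSdiag hTsymp hTorth q a b hX rfl
  have hval : 4 * a ^ 2 * β * (1 - d (Fin.castLE hpn q) / β) = 2 / N * (β * x ^ 2) := by
    change 4 * a ^ 2 * β * x = _
    rw [ha2]
    field_simp
    norm_num
  refine ⟨S * planeRot q a b * Tᵀ, ?_, ?_, ?_⟩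
  · have : (S * planeRot q a b * Tᵀ)ᵀ * (S * planeRot q a b * Tᵀ) =
        T * (planeRot q a (-b) * (Sᵀ * S * planeRot q a b)) * Tᵀ := by
      simp only [Matrix.transpose_mul, Matrix.transpose_transpose, planeRot_transpose,
        Matrix.mul_assoc]
    rw [this, trace_conj_of_orthogonal hTorth, Matrix.trace_mul_comm, mul_assoc,
      planeRot_mul_planeRot_neg, mul_smul_comm, Matrix.trace_smul, smul_eq_mul, ha2, hb2]
    change _ * N = 1
    field_simp
    ring
  · rw [hH, hval]
    refine mul_le_mul_of_nonneg_right ?_ (by positivity)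
    rwa [div_le_div_iff₀ hδpos hNpos]
  · rw [hH, hval]
    refine mul_le_mul_of_nonneg_right ?_ (by positivity)
    rwa [div_le_div_iff₀ hNpos hδpos]
end
end
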